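/- Let d ≥ 1, W ∈ S_{2,1}(ℝ^d), and let η = η₀ + η̃ be admissible with mean value η₀ = 0. Then there exist a constant C ∈ (0,∞) and E₀ < 0 such that N(E; ηW) ≤ C|ln|E|| for all E ∈ (E₀, 0). -/

import Mathlib

open MeasureTheory Filter Real Set Topology

noncomputable section

abbrev Ed (d : ℕ) := EuclideanSpace ℝ (Fin d)

/-- Glazman variational count of eigenvalues of `-Δ + V` below `E`. -/
noncomputable def schN (d : ℕ) (V : Ed d → ℝ) (E : ℝ) : ℕ∞ :=
  ⨆ F : {F : Submodule ℝ (Ed d → ℝ) //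
      (∀ u ∈ F, ContDiff ℝ (⊤ : ℕ∞) u ∧ HasCompactSupport u) ∧
      (∀ u ∈ F, u ≠ 0 →
        (∫ x, (‖gradient u x‖ ^ 2 + V x * u x ^ 2)) < E * ∫ x, u x ^ 2)},
    (Module.finrank ℝ F.1 : ℕ∞)

/-- Laplacian. -/
noncomputable def lap (d : ℕ) (φ : Ed d → ℝ) (x : Ed d) : ℝ :=
  ∑ i : Fin d, iteratedFDeriv ℝ 2 φ x ![EuclideanSpace.single i 1, EuclideanSpace.single i 1]

/-- The symbol class `S_{m,ρ}`. -/
def SClass (d m : ℕ) (ρ : ℝ) (W : Ed d → ℝ) : Prop :=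
  ContDiff ℝ m W ∧ ∃ C : ℝ, 0 < C ∧ ∀ k : ℕ, k ≤ m → ∀ x : Ed d,
    ‖iteratedFDeriv ℝ k W x‖ ≤ C * (1 + ‖x‖) ^ (-ρ - (k : ℝ))

/-- The cube `(-R/2, R/2)^d`. -/
def cube (d : ℕ) (R : ℝ) : Set (Ed d) := {x | ∀ i, |x i| < R / 2}

/-- Admissibility of `η` with mean value `η₀` witnessed by the solution `φ` of `Δφ = η - η₀`. -/
structure IsAdmissible (d : ℕ) (η : Ed d → ℝ) (η₀ : ℝ) (φ : Ed d → ℝ) : Prop where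
  background_ne : ∃ x, η x ≠ η₀
  smooth : ContDiff ℝ 2 φ
  bounded : ∀ k : ℕ, k ≤ 2 → ∃ M : ℝ, ∀ x, ‖iteratedFDeriv ℝ k φ x‖ ≤ M
  poisson : ∀ x, lap d φ x = η x - η₀
  normalized : Filter.limsup (fun R : ℝ => (∫ x in cube d R, φ x) / R ^ d) Filter.atTop = 0

/-- Volume of the unit ball of `ℝ^d`. -/
noncomputable def tau (d : ℕ) : ℝ := (volume (Metric.ball (0 : Ed d) 1)).toReal

/-- Semiclassical counting function. -/
noncomputable def Ncl (d : ℕ) (V : Ed d → ℝ) (E : ℝ) : ℝ :=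
  (tau d / (2 * π) ^ d) * ∫ x, (max (E - V x) 0) ^ ((d : ℝ) / 2)



open scoped ENNReal

lemma aux_cs {f : ℝ → ℝ} (hf : Continuous f) :
    (∫ t in (0:ℝ)..1, f t) ^ 2 ≤ ∫ t in (0:ℝ)..1, f t ^ 2 := by
  set a := ∫ t in (0:ℝ)..1, f t with ha
  have h0 : 0 ≤ ∫ t in (0:ℝ)..1, (f t - a) ^ 2 :=
    intervalIntegral.integral_nonneg (by norm_num) (fun t _ => sq_nonneg _)
  have h1 : ∫ t in (0:ℝ)..1, (f t - a) ^ 2 = (∫ t in (0:ℝ)..1, f t ^ 2) - a ^ 2 := by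
    have : ∀ t : ℝ, (f t - a) ^ 2 = f t ^ 2 - ((2 * a) * f t - a ^ 2) := by
      intro t; ring
    simp_rw [this]
    have c1 : Continuous fun t => f t ^ 2 := by fun_prop
    have c2 : Continuous fun t => (2 * a) * f t := by fun_prop
    have c3 : Continuous fun t => (2 * a) * f t - a ^ 2 := by fun_prop
    rw [intervalIntegral.integral_sub (c1.intervalIntegrable _ _) (c3.intervalIntegrable _ _),
      intervalIntegral.integral_sub (c2.intervalIntegrable _ _)
      (continuous_const.intervalIntegrable _ _), intervalIntegral.integral_const_mul, ← ha]
    simp; ring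
  linarith

lemma aux_ftc {d : ℕ} {u : Ed d → ℝ} (hu : ContDiff ℝ 1 u) (x v : Ed d) :
    ENNReal.ofReal ((u (x + v) - u x) ^ 2) ≤
      ENNReal.ofReal (‖v‖ ^ 2) *
        ∫⁻ t in Icc (0:ℝ) 1, ENNReal.ofReal (‖fderiv ℝ u (x + t • v)‖ ^ 2) := by
  have hc : Continuous (fderiv ℝ u) := hu.continuous_fderiv (by norm_num)
  have hcx : Continuous fun t : ℝ => fderiv ℝ u (x + t • v) := hc.comp (by fun_prop)
  have hcf : Continuous fun t : ℝ => fderiv ℝ u (x + t • v) v := hcx.clm_apply continuous_const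
  have hder : ∀ t : ℝ, HasDerivAt (fun t : ℝ => u (x + t • v)) (fderiv ℝ u (x + t • v) v) t := by
    intro t
    have h1 : HasFDerivAt u (fderiv ℝ u (x + t • v)) (x + t • v) :=
      (hu.differentiable (by norm_num) _).hasFDerivAt
    have h2 : HasDerivAt (fun t : ℝ => x + t • v) v t := by
      simpa using ((hasDerivAt_id t).smul_const v).const_add x
    exact h1.comp_hasDerivAt t h2
  set a := u (x + v) - u x with ha
  have hintg : ∫ t in (0:ℝ)..1, fderiv ℝ u (x + t • v) v = a := by
    rw [intervalIntegral.integral_eq_sub_of_hasDerivAt (fun t _ => hder t)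
      (hcf.intervalIntegrable _ _)]
    simp [ha]
  have hsq : a ^ 2 ≤ ∫ t in (0:ℝ)..1, (fderiv ℝ u (x + t • v) v) ^ 2 := by
    rw [← hintg]; exact aux_cs hcf
  have hle : a ^ 2 ≤ ∫ t in (0:ℝ)..1, ‖v‖ ^ 2 * ‖fderiv ℝ u (x + t • v)‖ ^ 2 := by
    refine hsq.trans (intervalIntegral.integral_mono_on (by norm_num)
      ((hcf.pow 2).intervalIntegrable _ _)
      ((continuous_const.mul (hcx.norm.pow 2)).intervalIntegrable _ _) ?_)
    intro t _
    rw [← mul_pow, ← sq_abs]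
    refine pow_le_pow_left₀ (abs_nonneg _) ?_ 2
    rw [mul_comm]
    exact (fderiv ℝ u (x + t • v)).le_opNorm v
  rw [intervalIntegral.integral_const_mul, intervalIntegral.integral_of_le (by norm_num),
    ← integral_Icc_eq_integral_Ioc] at hle
  refine (ENNReal.ofReal_le_ofReal hle).trans ?_
  rw [ENNReal.ofReal_mul (by positivity), ofReal_integral_eq_lintegral_ofReal]
  · exact (hcx.norm.pow 2).continuousOn.integrableOn_compact isCompact_Icc
  · exact Eventually.of_forall fun t => by positivity

lemma aux_cv {d : ℕ} {Q : Set (Ed d)} (hQm : MeasurableSet Q) (hQc : Convex ℝ Q)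
    {g : Ed d → ℝ≥0∞} (hg : Measurable g) {y : Ed d} (hy : y ∈ Q) {s : ℝ} (hs0 : 0 ≤ s)
    (hs : s ≤ 1 / 2) :
    ∫⁻ x in Q, g (x + s • (y - x)) ≤ 2 ^ d * ∫⁻ x in Q, g x := by
  have h1 : ∫⁻ x in Q, g (x + s • (y - x)) ≤ ∫⁻ x, (Q.indicator g) ((1 - s) • x + s • y) := by
    rw [← lintegral_indicator hQm]
    refine lintegral_mono fun x => ?_
    by_cases hx : x ∈ Q
    · have hm : (1 - s) • x + s • y ∈ Q := hQc hx hy (by linarith) hs0 (by ring)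
      rw [indicator_of_mem hx, indicator_of_mem hm]
      apply le_of_eq; congr 1; module
    · simp [indicator_of_notMem hx]
  have hind : Measurable (Q.indicator g) := hg.indicator hQm
  have h2 : ∫⁻ x, (Q.indicator g) ((1 - s) • x + s • y)
      = ENNReal.ofReal |((1 - s) ^ d)⁻¹| * ∫⁻ x, Q.indicator g x := by
    have hF : Measurable fun z => Q.indicator g (z + s • y) := hind.comp (by fun_prop)
    have : ∫⁻ x, (Q.indicator g) ((1 - s) • x + s • y) =
        ∫⁻ z, Q.indicator g (z + s • y) ∂(Measure.map (fun x => (1 - s) • x) volume) := by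
      rw [lintegral_map hF (by fun_prop)]
    rw [this, Measure.map_addHaar_smul volume (by linarith : (1 - s) ≠ 0), lintegral_smul_measure,
      lintegral_add_right_eq_self (fun z => Q.indicator g z)]
    simp
  rw [h2, lintegral_indicator hQm] at h1
  refine h1.trans ?_
  gcongr
  have : |((1 - s) ^ d)⁻¹| ≤ 2 ^ d := by
    rw [abs_of_nonneg (by apply inv_nonneg.2; apply pow_nonneg; linarith), ← inv_pow]
    refine pow_le_pow_left₀ (by apply inv_nonneg.2; linarith) ?_ d
    rw [inv_le_comm₀ (by linarith) (by norm_num)]; linarith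
  refine (ENNReal.ofReal_le_ofReal this).trans ?_
  rw [ENNReal.ofReal_pow (by norm_num)]; simp

lemma aux_dbl {d : ℕ} {Q : Set (Ed d)} (hQm : MeasurableSet Q) (hQc : Convex ℝ Q)
    {D : ℝ} (hD : ∀ x ∈ Q, ∀ y ∈ Q, ‖x - y‖ ^ 2 ≤ D)
    {u : Ed d → ℝ} (hu : ContDiff ℝ 1 u) :
    ∫⁻ y in Q, ∫⁻ x in Q, ENNReal.ofReal ((u (x + (1/2 : ℝ) • (y - x)) - u x) ^ 2) ≤
      ENNReal.ofReal D * 2 ^ d * volume Q *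
        ∫⁻ x in Q, ENNReal.ofReal (‖fderiv ℝ u x‖ ^ 2) := by
  have hc : Continuous (fderiv ℝ u) := hu.continuous_fderiv (by norm_num)
  set g : Ed d → ℝ≥0∞ := fun x => ENNReal.ofReal (‖fderiv ℝ u x‖ ^ 2) with hgdef
  have hgc : Continuous g := ENNReal.continuous_ofReal.comp (hc.norm.pow 2)
  have key : ∀ y ∈ Q, ∫⁻ x in Q, ENNReal.ofReal ((u (x + (1/2 : ℝ) • (y - x)) - u x) ^ 2) ≤
      ENNReal.ofReal D * (2 ^ d * ∫⁻ x in Q, g x) := by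
    intro y hy
    calc _ ≤ ∫⁻ x in Q, ENNReal.ofReal D *
          ∫⁻ t in Icc (0:ℝ) 1, g (x + (t * (1/2)) • (y - x)) := by
          refine setLIntegral_mono' hQm fun x hx => ?_
          refine (aux_ftc hu x _).trans ?_
          simp only [smul_smul]
          gcongr
          refine le_trans ?_ (hD y hy x hx)
          rw [norm_smul, mul_pow]
          have : ‖(1/2:ℝ)‖ ^ 2 ≤ 1 := by norm_num
          nlinarith [sq_nonneg ‖y - x‖]
      _ = ENNReal.ofReal D * ∫⁻ x in Q, 
          ∫⁻ t in Icc (0:ℝ) 1, g (x + (t * (1/2)) • (y - x)) := by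
          rw [lintegral_const_mul' _ _ ENNReal.ofReal_ne_top]
      _ = ENNReal.ofReal D * ∫⁻ t in Icc (0:ℝ) 1, ∫⁻ x in Q, 
           g (x + (t * (1/2)) • (y - x)) := by
          rw [lintegral_lintegral_swap]
          apply Measurable.aemeasurable
          apply Continuous.measurable
          exact hgc.comp (by fun_prop)
      _ ≤ ENNReal.ofReal D * ∫⁻ t in Icc (0:ℝ) 1, (2 ^ d * ∫⁻ x in Q, g x) := by
          gcongr ENNReal.ofReal D * ?_
          refine setLIntegral_mono' measurableSet_Icc fun t ht => ?_
          exact aux_cv hQm hQc hgc.measurable hy (by linarith [ht.1]) (by linarith [ht.2])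
      _ = _ := by simp
  calc _ ≤ ∫⁻ y in Q, ENNReal.ofReal D * (2 ^ d * ∫⁻ x in Q, g x) := setLIntegral_mono' hQm key
    _ = _ := by
      rw [setLIntegral_const]; ring

lemma aux_poincare {d : ℕ} {Q : Set (Ed d)} (hQm : MeasurableSet Q) (hQc : Convex ℝ Q)
    (hfin : volume Q ≠ ∞)
    {D : ℝ} (hD : ∀ x ∈ Q, ∀ y ∈ Q, ‖x - y‖ ^ 2 ≤ D)
    {u : Ed d → ℝ} (hu : ContDiff ℝ 1 u) (hcs : HasCompactSupport u)
    (hmean : ∫ x in Q, u x = 0) :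
    ∫⁻ x in Q, ENNReal.ofReal (u x ^ 2) ≤ 
      4 * (ENNReal.ofReal D * 2 ^ d) * ∫⁻ x in Q, ENNReal.ofReal (‖fderiv ℝ u x‖ ^ 2) := by
  have huc : Continuous u := hu.continuous
  have hui : Integrable u := huc.integrable_of_hasCompactSupport hcs
  have hu2 : Integrable (fun x => u x ^ 2) := by
    have h1 : Continuous fun x => u x ^ 2 := by fun_prop
    refine h1.integrable_of_hasCompactSupport ?_
    exact hcs.comp_left (g := fun t : ℝ => t ^ 2) (by simp)
  by_cases h0 : volume Q = 0
  · rw [setLIntegral_measure_zero _ _ h0]; simp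
  set G := ∫⁻ x in Q, ENNReal.ofReal (‖fderiv ℝ u x‖ ^ 2) with hG
  have : IsFiniteMeasure (volume.restrict Q) := ⟨by simpa using hfin.lt_top⟩
  -- lower bound
  have hlow : ∀ x, volume Q * ENNReal.ofReal (u x ^ 2) ≤
      ∫⁻ y in Q, ENNReal.ofReal ((u x - u y) ^ 2) := by
    intro x
    have hI : ∫ y in Q, (u x - u y) ^ 2 = volume.real Q * u x ^ 2 + ∫ y in Q, u y ^ 2 := by
      have : ∀ y, (u x - u y) ^ 2 = u x ^ 2 - (2 * u x * u y - u y ^ 2) := by intro y; ring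
      simp_rw [this]
      have i1 : Integrable (fun y => 2 * u x * u y) (volume.restrict Q) :=
        hui.restrict.const_mul _
      have i2 : Integrable (fun y => 2 * u x * u y - u y ^ 2) (volume.restrict Q) :=
        i1.sub hu2.restrict
      rw [integral_sub (integrable_const _) i2,
        integral_sub i1 hu2.restrict, integral_const_mul, hmean]
      simp
    have hintg : Integrable (fun y => (u x - u y) ^ 2) (volume.restrict Q) := by
      have : ∀ y, (u x - u y) ^ 2 = u x ^ 2 - (2 * u x * u y - u y ^ 2) := by intro y; ring
      simp_rw [this]
      exact (integrable_const _).sub ((hui.restrict.const_mul _).sub hu2.restrict)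
    rw [← ofReal_integral_eq_lintegral_ofReal hintg (Eventually.of_forall fun y => sq_nonneg _), hI]
    have h2 : 0 ≤ ∫ y in Q, u y ^ 2 := integral_nonneg fun y => sq_nonneg _
    calc volume Q * ENNReal.ofReal (u x ^ 2) = ENNReal.ofReal (volume.real Q * u x ^ 2) := by
          rw [ENNReal.ofReal_mul measureReal_nonneg, ofReal_measureReal hfin]
      _ ≤ _ := ENNReal.ofReal_le_ofReal (by linarith)
  set A : Ed d → Ed d → ℝ≥0∞ := fun x y =>
    ENNReal.ofReal ((u (x + (1/2 : ℝ) • (y - x)) - u x) ^ 2) with hA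
  have hAc : Continuous (Function.uncurry A) := by
    apply ENNReal.continuous_ofReal.comp
    apply Continuous.pow
    apply Continuous.sub
    · exact huc.comp (by fun_prop)
    · exact huc.comp (by fun_prop)
  have hAc' : Continuous (Function.uncurry fun y x => A x y) := hAc.comp continuous_swap
  have hpt : ∀ x y, ENNReal.ofReal ((u x - u y) ^ 2) ≤ 2 * A x y + 2 * A y x := by
    intro x y
    have hm : y + (1/2 : ℝ) • (x - y) = x + (1/2 : ℝ) • (y - x) := by module
    simp only [hA, hm]
    set m := u (x + (1/2 : ℝ) • (y - x))
    have h2 : (2 : ℝ≥0∞) = ENNReal.ofReal 2 := by simp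
    rw [h2, ← ENNReal.ofReal_mul (by norm_num), ← ENNReal.ofReal_mul (by norm_num),
      ← ENNReal.ofReal_add (by positivity) (by positivity)]
    apply ENNReal.ofReal_le_ofReal
    nlinarith [sq_nonneg ((u x - m) + (u y - m))]
  have hmain : volume Q * ∫⁻ x in Q, ENNReal.ofReal (u x ^ 2) ≤
      volume Q * (4 * (ENNReal.ofReal D * 2 ^ d) * G) := by
    calc _ = ∫⁻ x in Q, volume Q * ENNReal.ofReal (u x ^ 2) := by
          rw [lintegral_const_mul' _ _ hfin]
      _ ≤ ∫⁻ x in Q, ∫⁻ y in Q, (2 * A x y + 2 * A y x) :=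
          lintegral_mono fun x => (hlow x).trans (lintegral_mono fun y => hpt x y)
      _ = ∫⁻ x in Q, ((2 * ∫⁻ y in Q, A x y) + (2 * ∫⁻ y in Q, A y x)) := by
          congr 1; ext x
          have m1 : Measurable fun y => A x y := (hAc.comp (Continuous.prodMk_right x)).measurable
          have m2 : Measurable fun y => A y x := (hAc.comp (Continuous.prodMk_left x)).measurable
          rw [lintegral_add_left (m1.const_mul 2), lintegral_const_mul _ m1,
            lintegral_const_mul _ m2]
      _ = 2 * (∫⁻ x in Q, ∫⁻ y in Q, A x y) + 2 * (∫⁻ x in Q, ∫⁻ y in Q, A y x) := by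
          rw [lintegral_add_left, lintegral_const_mul' _ _ (by simp), lintegral_const_mul' _ _ (by simp)]
          exact (Measurable.lintegral_prod_right hAc.measurable).const_mul 2
      _ = 4 * (∫⁻ x in Q, ∫⁻ y in Q, A y x) := by
          rw [lintegral_lintegral_swap hAc.measurable.aemeasurable, ← add_mul]; norm_num
      _ ≤ 4 * (ENNReal.ofReal D * 2 ^ d * volume Q * G) := by
          gcongr; exact aux_dbl hQm hQc hD hu
      _ = _ := by ring
  exact (ENNReal.mul_le_mul_iff_right h0 hfin).1 hmain

lemma aux_int_sq {d : ℕ} {u : Ed d → ℝ} (huc : Continuous u) (hcs : HasCompactSupport u)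
    {p : Ed d → ℝ} (hp : Continuous p) : Integrable (fun x => p x * u x ^ 2) := by
  have h1 : Continuous fun x => p x * u x ^ 2 := by fun_prop
  refine h1.integrable_of_hasCompactSupport ?_
  have h2 : HasCompactSupport fun x => u x ^ 2 :=
    hcs.comp_left (g := fun t : ℝ => t ^ 2) (by simp)
  exact h2.mul_left

lemma aux_int_grad {d : ℕ} {u : Ed d → ℝ} (hu : ContDiff ℝ 1 u) (hcs : HasCompactSupport u) :
    Integrable (fun x => ‖fderiv ℝ u x‖ ^ 2) := by
  have hc : Continuous (fderiv ℝ u) := hu.continuous_fderiv (by norm_num)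
  have h1 : Continuous fun x => ‖fderiv ℝ u x‖ ^ 2 := by fun_prop
  refine h1.integrable_of_hasCompactSupport ?_
  exact (hcs.fderiv ℝ).comp_left (g := fun t => ‖t‖ ^ 2) (by simp)

lemma aux_poincare_real {d : ℕ} {Q : Set (Ed d)} (hQm : MeasurableSet Q) (hQc : Convex ℝ Q)
    (hfin : volume Q ≠ ∞)
    {D : ℝ} (hD0 : 0 ≤ D) (hD : ∀ x ∈ Q, ∀ y ∈ Q, ‖x - y‖ ^ 2 ≤ D)
    {u : Ed d → ℝ} (hu : ContDiff ℝ 1 u) (hcs : HasCompactSupport u)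
    (hmean : ∫ x in Q, u x = 0) :
    ∫ x in Q, u x ^ 2 ≤ 4 * (D * 2 ^ d) * ∫ x in Q, ‖fderiv ℝ u x‖ ^ 2 := by
  have h := aux_poincare hQm hQc hfin hD hu hcs hmean
  have i1 : Integrable (fun x => u x ^ 2) (volume.restrict Q) := by
    simpa using (aux_int_sq hu.continuous hcs (p := fun _ => 1) continuous_const).restrict
  have i2 := (aux_int_grad hu hcs).restrict (s := Q)
  rw [← ofReal_integral_eq_lintegral_ofReal i1 (Eventually.of_forall fun y => sq_nonneg _),
    ← ofReal_integral_eq_lintegral_ofReal i2 (Eventually.of_forall fun y => sq_nonneg _)] at h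
  have hnn : 0 ≤ ∫ x in Q, ‖fderiv ℝ u x‖ ^ 2 := integral_nonneg fun y => sq_nonneg _
  rw [← ENNReal.ofReal_le_ofReal_iff (by positivity), ENNReal.ofReal_mul (by positivity),
    ENNReal.ofReal_mul (by positivity), ENNReal.ofReal_mul (by positivity),
    ENNReal.ofReal_pow (by positivity)]
  simpa using h

/-- Half-open grid cell. -/
def qcell (d : ℕ) (l : ℝ) (z : Fin d → ℤ) : Set (Ed d) := {x | ∀ i, ⌊x i / l⌋ = z i}

/-- Half-open box. -/
def hbox (d : ℕ) (r : ℝ) : Set (Ed d) := {x | ∀ i, -r ≤ x i ∧ x i < r}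

lemma mem_qcell {d : ℕ} {l : ℝ} (hl : 0 < l) {z : Fin d → ℤ} {x : Ed d} :
    x ∈ qcell d l z ↔ ∀ i, z i * l ≤ x i ∧ x i < (z i + 1) * l := by
  simp only [qcell, mem_ofPred_eq, Int.floor_eq_iff, le_div_iff₀ hl, div_lt_iff₀ hl]

lemma measurable_qcell (d : ℕ) (l : ℝ) (z : Fin d → ℤ) : MeasurableSet (qcell d l z) := by
  have : qcell d l z = ⋂ i, {x : Ed d | ⌊x i / l⌋ = z i} := by ext; simp [qcell]
  rw [this]
  refine MeasurableSet.iInter fun i => ?_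
  have hm : Measurable fun x : Ed d => ⌊x i / l⌋ :=
    Int.measurable_floor.comp (by fun_prop)
  exact hm (measurableSet_singleton (z i))

lemma measurable_hbox (d : ℕ) (r : ℝ) : MeasurableSet (hbox d r) := by
  have : hbox d r = ⋂ i, {x : Ed d | x i ∈ Ico (-r) r} := by ext; simp [hbox]
  rw [this]
  refine MeasurableSet.iInter fun i => ?_
  have hm : Measurable fun x : Ed d => x i := by fun_prop
  exact hm measurableSet_Ico

lemma convex_qcell {d : ℕ} {l : ℝ} (hl : 0 < l) (z : Fin d → ℤ) : Convex ℝ (qcell d l z) := by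
  intro x hx y hy a b ha hb hab
  rw [mem_qcell hl] at *
  intro i
  have := (convex_Ico (z i * l) ((z i + 1) * l)) (hx i) (hy i) ha hb hab
  simpa using this

lemma diam_qcell {d : ℕ} {l : ℝ} (hl : 0 < l) (z : Fin d → ℤ) :
    ∀ x ∈ qcell d l z, ∀ y ∈ qcell d l z, ‖x - y‖ ^ 2 ≤ d * l ^ 2 := by
  intro x hx y hy
  rw [mem_qcell hl] at *
  rw [EuclideanSpace.norm_sq_eq]
  calc _ ≤ ∑ i : Fin d, l ^ 2 := by
        refine Finset.sum_le_sum fun i _ => ?_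
        rw [Real.norm_eq_abs]
        refine pow_le_pow_left₀ (abs_nonneg _) ?_ 2
        have h1 := hx i; have h2 := hy i
        simp only [PiLp.sub_apply]
        rw [abs_le]; constructor <;> nlinarith
    _ = _ := by simp

lemma volume_qcell {d : ℕ} {l : ℝ} (hl : 0 < l) (z : Fin d → ℤ) :
    volume (qcell d l z) ≠ ∞ := by
  have hb : Bornology.IsBounded (qcell d l z) := by
    rw [Metric.isBounded_iff]
    refine ⟨√(d * l ^ 2), fun x hx y hy => ?_⟩
    rw [dist_eq_norm]
    exact Real.le_sqrt_of_sq_le (diam_qcell hl z x hx y hy)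
  exact hb.measure_lt_top.ne

lemma aux_cells {d : ℕ} {l : ℝ} (hl : 0 < l) (S : Finset (Fin d → ℤ)) {A : Set (Ed d)}
    (hA : ∀ x : Ed d, x ∈ A ↔ (fun i => ⌊x i / l⌋) ∈ S) {P : ℝ} (hP0 : 0 ≤ P)
    {p : Ed d → ℝ} (hpc : Continuous p) (hp : ∀ x ∈ A, p x ≤ P)
    (hPl : P * (4 * (d * l ^ 2 * 2 ^ d)) ≤ 1)
    {u : Ed d → ℝ} (hu : ContDiff ℝ 1 u) (hcs : HasCompactSupport u)
    (hmean : ∀ z ∈ S, ∫ x in qcell d l z, u x = 0) :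
    ∫ x in A, p x * u x ^ 2 ≤ ∫ x in A, ‖fderiv ℝ u x‖ ^ 2 := by
  have hAU : A = ⋃ z ∈ S, qcell d l z := by
    ext x
    rw [hA]
    simp only [mem_iUnion, qcell, mem_ofPred_eq]
    constructor
    · intro h; exact ⟨_, h, fun i => rfl⟩
    · rintro ⟨z, hz, h⟩
      have : (fun i => ⌊x i / l⌋) = z := funext h
      rwa [this]
  have hdis : (↑S : Set (Fin d → ℤ)).Pairwise (Function.onFun Disjoint (qcell d l)) := by
    intro z _ z' _ hne
    rw [Function.onFun, Set.disjoint_left]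
    intro x hx hx'
    exact hne (funext fun i => (hx i).symm.trans (hx' i))
  have i1 := aux_int_sq hu.continuous hcs hpc
  have i0 : Integrable (fun x => u x ^ 2) := by
    simpa using aux_int_sq hu.continuous hcs (p := fun _ => 1) continuous_const
  have i2 := aux_int_grad hu hcs
  have hAm : ∀ z ∈ S, qcell d l z ⊆ A := by
    intro z hz; rw [hAU]; exact subset_biUnion_of_mem (u := qcell d l) hz
  have e1 : ∫ x in A, p x * u x ^ 2 = ∑ z ∈ S, ∫ x in qcell d l z, p x * u x ^ 2 := by
    rw [hAU]
    exact integral_biUnion_finset S (fun z _ => measurable_qcell d l z) hdis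
      (fun z _ => i1.integrableOn)
  have e2 : ∫ x in A, ‖fderiv ℝ u x‖ ^ 2 = ∑ z ∈ S, ∫ x in qcell d l z, ‖fderiv ℝ u x‖ ^ 2 := by
    rw [hAU]
    exact integral_biUnion_finset S (fun z _ => measurable_qcell d l z) hdis
      (fun z _ => i2.integrableOn)
  rw [e1, e2]
  refine Finset.sum_le_sum fun z hz => ?_
  have hG : 0 ≤ ∫ x in qcell d l z, ‖fderiv ℝ u x‖ ^ 2 := integral_nonneg fun y => sq_nonneg _
  calc ∫ x in qcell d l z, p x * u x ^ 2 ≤ ∫ x in qcell d l z, P * u x ^ 2 := by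
        refine setIntegral_mono_on i1.integrableOn (i0.const_mul P).integrableOn
          (measurable_qcell d l z) fun x hx => ?_
        exact mul_le_mul_of_nonneg_right (hp x (hAm z hz hx)) (sq_nonneg _)
    _ = P * ∫ x in qcell d l z, u x ^ 2 := integral_const_mul _ _
    _ ≤ P * (4 * (d * l ^ 2 * 2 ^ d) * ∫ x in qcell d l z, ‖fderiv ℝ u x‖ ^ 2) := by
        gcongr
        exact aux_poincare_real (measurable_qcell d l z) (convex_qcell hl z) (volume_qcell hl z)
          (by positivity) (diam_qcell hl z) hu hcs (hmean z hz)
    _ ≤ 1 * ∫ x in qcell d l z, ‖fderiv ℝ u x‖ ^ 2 := by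
        rw [← mul_assoc]; gcongr
    _ = _ := one_mul _

lemma mem_hbox_floor {d : ℕ} {l : ℝ} (hl : 0 < l) (m : ℕ) (x : Ed d) :
    x ∈ hbox d (m * l) ↔
      (fun i => ⌊x i / l⌋) ∈ Fintype.piFinset fun _ : Fin d => Finset.Ico (-(m : ℤ)) m := by
  simp only [hbox, mem_ofPred_eq, Fintype.mem_piFinset, Finset.mem_Ico, Int.le_floor, Int.floor_lt,
    le_div_iff₀ hl, div_lt_iff₀ hl]
  push_cast
  simp only [neg_mul]

/-- The Hardy type weight. -/
def hw (d : ℕ) (κ : ℝ) (x : Ed d) : ℝ := κ / (1 + ‖x‖) ^ 2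

lemma continuous_hw (d : ℕ) (κ : ℝ) : Continuous (hw d κ) := by
  unfold hw
  refine continuous_const.div (by fun_prop) fun x => ?_
  positivity

lemma hw_le_of_notMem {d : ℕ} {κ r : ℝ} (hκ : 0 ≤ κ) (hr : 0 < r) {x : Ed d}
    (hx : x ∉ hbox d r) : hw d κ x ≤ κ / r ^ 2 := by
  have : r ≤ ‖x‖ := by
    simp only [hbox, mem_ofPred_eq, not_forall, not_and_or, not_le, not_lt] at hx
    obtain ⟨i, hi⟩ := hx
    have h1 : ‖x i‖ ≤ ‖x‖ := PiLp.norm_apply_le x i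
    refine le_trans ?_ h1
    rw [Real.norm_eq_abs, le_abs]
    rcases hi with h | h
    · right; linarith
    · left; exact h
  unfold hw
  gcongr
  linarith

lemma aux_tower {d : ℕ} {κ : ℝ} (hκ : 0 ≤ κ) {n : ℕ} (hn : 1 ≤ n)
    (hκn : κ * (4 * (d * 2 ^ d)) ≤ n) (k : ℕ) :
    ∃ s : Finset (Set (Ed d)), s.card ≤ (k + 1) * (4 * n) ^ d ∧
      ∀ u : Ed d → ℝ, ContDiff ℝ 1 u → HasCompactSupport u →
        (∀ Q ∈ s, ∫ x in Q, u x = 0) →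
        ∫ x in hbox d (2 ^ k), hw d κ x * u x ^ 2 ≤ ∫ x in hbox d (2 ^ k), ‖fderiv ℝ u x‖ ^ 2 := by
  classical
  have hn' : (1:ℝ) ≤ n := by exact_mod_cast hn
  have hn0 : (0:ℝ) < n := by linarith
  set B : ℕ → Finset (Fin d → ℤ) := fun m =>
    Fintype.piFinset fun _ : Fin d => Finset.Ico (-(m : ℤ)) m with hB
  have hBcard : (B (2 * n)).card = (4 * n) ^ d := by
    simp only [hB, Fintype.card_piFinset, Int.card_Ico, Finset.prod_const, Finset.card_univ,
      Fintype.card_fin]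
    congr 1
    omega
  have hsm : ∀ k : ℕ, κ / (2 ^ k) ^ 2 * (4 * (d * ((2:ℝ) ^ k / n) ^ 2 * 2 ^ d)) ≤ 1 := by
    intro k
    have h2 : (0:ℝ) < 2 ^ k := by positivity
    have : κ / (2 ^ k) ^ 2 * (4 * (d * ((2:ℝ) ^ k / n) ^ 2 * 2 ^ d))
      = (κ * (4 * (d * 2 ^ d))) / n ^ 2 := by
      field_simp
    rw [this, div_le_one (by positivity)]
    nlinarith
  induction k with
  | zero =>
    refine ⟨(B n).image (qcell d (2 ^ 0 / n)), ?_, ?_⟩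
    · refine Finset.card_image_le.trans ?_
      rw [zero_add, one_mul, ← hBcard]
      refine Finset.card_le_card ?_
      refine Fintype.piFinset_subset _ _ fun i => ?_
      apply Finset.Ico_subset_Ico <;> push_cast <;> omega
    · intro u hu hcs hm
      refine aux_cells (l := 2 ^ 0 / n) (by positivity) (B n) ?_ (P := κ / (2 ^ 0) ^ 2)
        (by positivity) (continuous_hw d κ) ?_ (hsm 0) hu hcs ?_
      · intro x
        have := mem_hbox_floor (d := d) (l := 2 ^ 0 / n) (by positivity) n x
        rwa [mul_div_cancel₀ _ hn0.ne'] at this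
      · intro x _
        unfold hw
        gcongr
        simp
      · intro z hz; exact hm _ (Finset.mem_image_of_mem _ hz)
  | succ k ih =>
    obtain ⟨s, hs, hsu⟩ := ih
    refine ⟨s ∪ (B (2 * n) \ B n).image (qcell d (2 ^ k / n)), ?_, ?_⟩
    · refine (Finset.card_union_le _ _).trans ?_
      have : ((B (2 * n) \ B n).image (qcell d (2 ^ k / n))).card ≤ (4 * n) ^ d := by
        refine Finset.card_image_le.trans ?_
        rw [← hBcard]
        exact Finset.card_le_card Finset.sdiff_subset
      calc _ ≤ (k + 1) * (4 * n) ^ d + (4 * n) ^ d := by gcongr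
        _ = _ := by ring
    · intro u hu hcs hm
      have h1 := hsu u hu hcs fun Q hQ => hm Q (Finset.mem_union_left _ hQ)
      have hin : ∀ x, x ∈ hbox d (2 ^ k) ↔ (fun i => ⌊x i / (2 ^ k / n)⌋) ∈ B n := by
        intro x
        have := mem_hbox_floor (d := d) (l := 2 ^ k / n) (by positivity) n x
        rwa [mul_div_cancel₀ _ hn0.ne'] at this
      have hout : ∀ x, x ∈ hbox d (2 ^ (k + 1)) ↔ (fun i => ⌊x i / (2 ^ k / n)⌋) ∈ B (2 * n) := by
        intro x
        have := mem_hbox_floor (d := d) (l := 2 ^ k / n) (by positivity) (2 * n) x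
        have e : ((2 * n : ℕ) : ℝ) * (2 ^ k / n) = 2 ^ (k + 1) := by
          push_cast; field_simp; ring
        rwa [e] at this
      have h2 : ∫ x in hbox d (2 ^ (k + 1)) \ hbox d (2 ^ k), hw d κ x * u x ^ 2 ≤
          ∫ x in hbox d (2 ^ (k + 1)) \ hbox d (2 ^ k), ‖fderiv ℝ u x‖ ^ 2 := by
        refine aux_cells (l := 2 ^ k / n) (by positivity) (B (2 * n) \ B n) ?_
          (P := κ / (2 ^ k) ^ 2) (by positivity) (continuous_hw d κ) ?_ (hsm k) hu hcs ?_
        · intro x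
          rw [Set.mem_sdiff, hin, hout, Finset.mem_sdiff]
        · intro x hx
          exact hw_le_of_notMem hκ (by positivity) hx.2
        · intro z hz
          exact hm _ (Finset.mem_union_right _ (Finset.mem_image_of_mem _ hz))
      have hsub : hbox d (2 ^ k) ⊆ hbox d (2 ^ (k + 1)) := by
        intro x hx i
        have h2 : (0:ℝ) < 2 ^ k := by positivity
        have := hx i
        rw [pow_succ]
        constructor <;> linarith
      have i1 := aux_int_sq hu.continuous hcs (continuous_hw d κ)
      have i2 := aux_int_grad hu hcs
      rw [setIntegral_sdiff (measurable_hbox _ _) i1.integrableOn hsub,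
        setIntegral_sdiff (measurable_hbox _ _) i2.integrableOn hsub] at h2
      linarith

lemma aux_ibp {d : ℕ} {φ f : Ed d → ℝ} (hφ : ContDiff ℝ 2 φ) (hf : ContDiff ℝ 1 f)
    (hcs : HasCompactSupport f) :
    ∫ x, lap d φ x * f x =
      - ∫ x, ∑ i : Fin d, fderiv ℝ f x (EuclideanSpace.single i 1) *
        fderiv ℝ φ x (EuclideanSpace.single i 1) := by
  have hφ1 : ContDiff ℝ 1 (fderiv ℝ φ) := hφ.fderiv_right (by norm_num)
  have hφ2 : Continuous (fderiv ℝ (fderiv ℝ φ)) := hφ1.continuous_fderiv (by norm_num)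
  have hf1 : Continuous (fderiv ℝ f) := hf.continuous_fderiv (by norm_num)
  have hcs' : HasCompactSupport (fderiv ℝ f) := hcs.fderiv ℝ
  have hφc := hφ1.continuous
  have hfc := hf.continuous
  have hI1 : ∀ v : Ed d, Integrable fun x => fderiv ℝ f x v * fderiv ℝ φ x v := by
    intro v
    have c : Continuous fun x => fderiv ℝ f x v * fderiv ℝ φ x v := by fun_prop
    refine c.integrable_of_hasCompactSupport ?_
    exact (hcs'.comp_left (g := fun L : Ed d →L[ℝ] ℝ => L v) (by simp)).mul_right
  have hI2 : ∀ v : Ed d, Integrable fun x => f x * fderiv ℝ (fderiv ℝ φ) x v v := by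
    intro v
    have c : Continuous fun x => f x * fderiv ℝ (fderiv ℝ φ) x v v := by fun_prop
    exact c.integrable_of_hasCompactSupport hcs.mul_right
  have key : ∀ v : Ed d, ∫ x, f x * fderiv ℝ (fderiv ℝ φ) x v v =
      - ∫ x, fderiv ℝ f x v * fderiv ℝ φ x v := by
    intro v
    have hg : ∀ x, fderiv ℝ (fun y => fderiv ℝ φ y v) x v = fderiv ℝ (fderiv ℝ φ) x v v := by
      intro x
      rw [fderiv_clm_apply (hφ1.differentiable (by norm_num) x) (differentiableAt_const v)]
      simp
    have := integral_mul_fderiv_eq_neg_fderiv_mul_of_integrable (μ := volume) (f := f)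
      (g := fun y => fderiv ℝ φ y v) (v := v) (hI1 v) (by simpa only [hg] using hI2 v) ?_ ?_ ?_
    · simpa only [hg] using this
    · have c : Continuous fun x => f x * fderiv ℝ φ x v := by fun_prop
      exact c.integrable_of_hasCompactSupport hcs.mul_right
    · intro x _; exact hf.differentiable (by norm_num) x
    · intro x _
      exact (hφ1.differentiable (by norm_num) x).clm_apply (differentiableAt_const v)
  rw [integral_finsetSum _ fun i _ => hI1 _, ← Finset.sum_neg_distrib]
  simp_rw [← key]
  rw [← integral_finsetSum _ fun i _ => hI2 _]
  congr 1; ext x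
  simp only [lap, iteratedFDeriv_two_apply, Finset.sum_mul]
  refine Finset.sum_congr rfl fun i _ => ?_
  simp [mul_comm]

lemma norm_gradient_eq {d : ℕ} (u : Ed d → ℝ) (x : Ed d) : ‖gradient u x‖ = ‖fderiv ℝ u x‖ := by
  simp [gradient]

lemma aux_form {d : ℕ} {W : Ed d → ℝ} (hW : SClass d 2 1 W)
    {η φ : Ed d → ℝ} (hη : IsAdmissible d η 0 φ) :
    ∃ K : ℝ, 1 ≤ K ∧ ∀ u : Ed d → ℝ, ContDiff ℝ 1 u → HasCompactSupport u →
      (1 / 2) * (∫ x, ‖fderiv ℝ u x‖ ^ 2) - ∫ x, hw d K x * u x ^ 2 ≤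
        ∫ x, (‖gradient u x‖ ^ 2 + (η x * W x) * u x ^ 2) := by
  obtain ⟨hWc, C, hC, hWb⟩ := hW
  obtain ⟨M, hM⟩ := hη.bounded 1 (by norm_num)
  have hφ := hη.smooth
  have hM0 : 0 ≤ M := (norm_nonneg _).trans (hM 0)
  have hW1 : ContDiff ℝ 1 W := hWc.of_le (by norm_num)
  have b0 : ∀ x, |W x| ≤ C / (1 + ‖x‖) := by
    intro x
    have := hWb 0 (by norm_num) x
    have h1 : 0 < 1 + ‖x‖ := by positivity
    rw [norm_iteratedFDeriv_zero, Nat.cast_zero, sub_zero, Real.rpow_neg_one] at this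
    simpa [div_eq_mul_inv] using this
  have b1 : ∀ x, ‖fderiv ℝ W x‖ ≤ C / (1 + ‖x‖) ^ 2 := by
    intro x
    have := hWb 1 (by norm_num) x
    have h1 : 0 < 1 + ‖x‖ := by positivity
    rw [norm_iteratedFDeriv_one, Nat.cast_one, show (-1 - 1 : ℝ) = -(2:ℕ) by norm_num,
      Real.rpow_neg h1.le, Real.rpow_natCast] at this
    simpa [div_eq_mul_inv] using this
  have b2 : ∀ x, ‖fderiv ℝ φ x‖ ≤ M := by
    intro x; simpa [norm_iteratedFDeriv_one] using hM x
  set a : ℝ := d * C * M with ha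
  have ha0 : 0 ≤ a := by positivity
  refine ⟨a + 2 * a ^ 2 + 1, by nlinarith [sq_nonneg a], ?_⟩
  set K := a + 2 * a ^ 2 + 1 with hK
  intro u hu hcs
  have hηeq : ∀ x, η x = lap d φ x := fun x => by have := hη.poisson x; linarith
  set f : Ed d → ℝ := fun x => W x * u x ^ 2 with hf
  have hfc : ContDiff ℝ 1 f := hW1.mul (hu.pow 2)
  have hfs : HasCompactSupport f := by
    have h2 : HasCompactSupport fun x => u x ^ 2 :=
      hcs.comp_left (g := fun t : ℝ => t ^ 2) (by simp)
    exact h2.mul_left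
  have hfd : ∀ x v, fderiv ℝ f x v = fderiv ℝ W x v * u x ^ 2 + 2 * W x * u x * fderiv ℝ u x v := by
    intro x v
    have h1 := (hW1.differentiable (by norm_num) x).hasFDerivAt
    have h2 := (hu.differentiable (by norm_num) x).hasFDerivAt
    have h3 := h1.mul (h2.pow 2)
    have h4 : fderiv ℝ f x = _ := h3.fderiv
    rw [h4]
    simp
    ring
  have hpt : ∀ x, ∑ i : Fin d, fderiv ℝ f x (EuclideanSpace.single i 1) *
        fderiv ℝ φ x (EuclideanSpace.single i 1) ≤
        (1 / 2) * ‖fderiv ℝ u x‖ ^ 2 + hw d K x * u x ^ 2 := by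
    intro x
    set r := 1 + ‖x‖ with hr
    have hr0 : 0 < r := by positivity
    set G := ‖fderiv ℝ u x‖ with hG
    have hG0 : 0 ≤ G := norm_nonneg _
    have hi : ∀ i : Fin d, fderiv ℝ f x (EuclideanSpace.single i 1) *
        fderiv ℝ φ x (EuclideanSpace.single i 1) ≤
        (C / r ^ 2 * u x ^ 2 + 2 * (C / r) * |u x| * G) * M := by
      intro i
      set e : Ed d := EuclideanSpace.single i 1 with he
      have hen : ‖e‖ = 1 := by simp [he]
      have h1 : |fderiv ℝ W x e| ≤ C / r ^ 2 := by
        have := (fderiv ℝ W x).le_opNorm e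
        rw [hen, mul_one] at this
        exact this.trans (b1 x)
      have h2 : |fderiv ℝ u x e| ≤ G := by
        have := (fderiv ℝ u x).le_opNorm e
        rwa [hen, mul_one] at this
      have h3 : |fderiv ℝ φ x e| ≤ M := by
        have := (fderiv ℝ φ x).le_opNorm e
        rw [hen, mul_one] at this
        exact this.trans (b2 x)
      refine (le_abs_self _).trans ?_
      rw [abs_mul, hfd]
      refine mul_le_mul ?_ h3 (abs_nonneg _) (by positivity)
      refine (abs_add_le _ _).trans ?_
      rw [abs_mul, abs_mul, abs_mul, abs_mul, abs_two, abs_of_nonneg (sq_nonneg (u x))]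
      have h4 := b0 x
      gcongr
    refine (Finset.sum_le_sum fun i _ => hi i).trans ?_
    rw [Finset.sum_const, Finset.card_univ, Fintype.card_fin, nsmul_eq_mul]
    set t := |u x| / r with ht
    have hut : u x ^ 2 / r ^ 2 = t ^ 2 := by rw [ht, div_pow, sq_abs]
    have e1 : (d : ℝ) * ((C / r ^ 2 * u x ^ 2 + 2 * (C / r) * |u x| * G) * M)
        = a * t ^ 2 + 2 * a * t * G := by
      rw [← hut, ha, ht]; field_simp
    have e2 : hw d K x * u x ^ 2 = K * t ^ 2 := by
      rw [← hut]; unfold hw; rw [← hr]; field_simp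
    rw [e1, e2, hK]
    nlinarith [sq_nonneg (G - 2 * a * t), sq_nonneg t]
  have hηc : Continuous η := by
    have hφ1 : ContDiff ℝ 1 (fderiv ℝ φ) := hφ.fderiv_right (by norm_num)
    have hφ2 : Continuous (fderiv ℝ (fderiv ℝ φ)) := hφ1.continuous_fderiv (by norm_num)
    have : η = fun x => ∑ i : Fin d, fderiv ℝ (fderiv ℝ φ) x (EuclideanSpace.single i 1)
        (EuclideanSpace.single i 1) := by
      ext x; rw [hηeq]; simp [lap, iteratedFDeriv_two_apply]
    rw [this]
    fun_prop
  have hWcont := hW1.continuous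
  have i1 := aux_int_grad hu hcs
  have i2 := aux_int_sq hu.continuous hcs (p := fun x => η x * W x) (by fun_prop)
  have i3 := aux_int_sq hu.continuous hcs (continuous_hw d K)
  have hV : ∫ x, (η x * W x) * u x ^ 2 = - ∫ x, ∑ i : Fin d,
      fderiv ℝ f x (EuclideanSpace.single i 1) * fderiv ℝ φ x (EuclideanSpace.single i 1) := by
    rw [← aux_ibp hφ hfc hfs]
    congr 1; ext x; rw [hηeq, hf]; ring
  have hle : ∫ x, ∑ i : Fin d,
      fderiv ℝ f x (EuclideanSpace.single i 1) * fderiv ℝ φ x (EuclideanSpace.single i 1) ≤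
      ∫ x, ((1 / 2) * ‖fderiv ℝ u x‖ ^ 2 + hw d K x * u x ^ 2) := by
    refine integral_mono ?_ ((i1.const_mul _).add i3) hpt
    refine integrable_finsetSum _ fun i _ => ?_
    have hf1 : Continuous (fderiv ℝ f) := hfc.continuous_fderiv (by norm_num)
    have hφ1 : Continuous (fderiv ℝ φ) := hφ.continuous_fderiv (by norm_num)
    have c : Continuous fun x => fderiv ℝ f x (EuclideanSpace.single i 1) *
      fderiv ℝ φ x (EuclideanSpace.single i 1) := by fun_prop
    refine c.integrable_of_hasCompactSupport ?_
    exact ((hfs.fderiv ℝ).comp_left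
      (g := fun L : Ed d →L[ℝ] ℝ => L (EuclideanSpace.single i 1)) (by simp)).mul_right
  rw [integral_add (i1.const_mul _) i3, integral_const_mul] at hle
  simp_rw [norm_gradient_eq]
  rw [integral_add i1 i2, hV]
  linarith

lemma aux_count {d : ℕ} {V : Ed d → ℝ} {K : ℝ} (hK : 1 ≤ K)
    (hV : ∀ u : Ed d → ℝ, ContDiff ℝ 1 u → HasCompactSupport u →
      (1 / 2) * (∫ x, ‖fderiv ℝ u x‖ ^ 2) - ∫ x, hw d K x * u x ^ 2 ≤
        ∫ x, (‖gradient u x‖ ^ 2 + V x * u x ^ 2))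
    {n : ℕ} (hn : 1 ≤ n) (hκn : (2 * K) * (4 * (d * 2 ^ d)) ≤ n) {k : ℕ} {E : ℝ}
    (hE : K / (2 ^ k) ^ 2 ≤ -E) :
    schN d V E ≤ (((k + 1) * (4 * n) ^ d : ℕ) : ℕ∞) := by
  obtain ⟨s, hs, hsu⟩ := aux_tower (d := d) (κ := 2 * K) (by linarith) hn hκn k
  unfold schN
  refine iSup_le ?_
  rintro ⟨F, hF1, hF2⟩
  refine Nat.cast_le.2 (le_trans ?_ hs)
  by_contra hlt
  push Not at hlt
  have hfd : FiniteDimensional ℝ F := FiniteDimensional.of_finrank_pos (by simp only at hlt; omega)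
  have hintg : ∀ u ∈ F, Integrable u := fun u hu =>
    (hF1 u hu).1.continuous.integrable_of_hasCompactSupport (hF1 u hu).2
  let T : F →ₗ[ℝ] (s → ℝ) :=
    { toFun := fun u Q => ∫ x in Q.1, u.1 x
      map_add' := by
        intro u v; ext Q
        exact integral_add (hintg u.1 u.2).restrict (hintg v.1 v.2).restrict
      map_smul' := by
        intro c u; ext Q
        exact integral_const_mul c _ }
  have hker : LinearMap.ker T ≠ ⊥ := by
    apply LinearMap.ker_ne_bot_of_finrank_lt
    simpa using hlt
  obtain ⟨⟨u, huF⟩, hTu, hu0⟩ := Submodule.exists_mem_ne_zero_of_ne_bot hker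
  have hune : u ≠ 0 := fun h => hu0 (by ext1; exact h)
  obtain ⟨husm, hcs⟩ := hF1 u huF
  have hu1 : ContDiff ℝ 1 u := husm.of_le (by exact_mod_cast le_top)
  have h1 := hF2 u huF hune
  have h2 := hV u hu1 hcs
  have h3 := hsu u hu1 hcs fun Q hQ => congrFun (LinearMap.mem_ker.1 hTu) ⟨Q, hQ⟩
  have i1 := aux_int_grad hu1 hcs
  have i3 := aux_int_sq hu1.continuous hcs (continuous_hw d K)
  have i0 : Integrable (fun x => u x ^ 2) := by
    simpa using aux_int_sq hu1.continuous hcs (p := fun _ => 1) continuous_const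
  set B := hbox d (2 ^ k) with hB
  have hBm : MeasurableSet B := measurable_hbox _ _
  have e3 : ∫ x in B, hw d (2 * K) x * u x ^ 2 = 2 * ∫ x in B, hw d K x * u x ^ 2 := by
    rw [← integral_const_mul]; congr 1; ext x; unfold hw; ring
  have h4 : ∫ x in B, ‖fderiv ℝ u x‖ ^ 2 ≤ ∫ x, ‖fderiv ℝ u x‖ ^ 2 :=
    setIntegral_le_integral i1 (Eventually.of_forall fun x => sq_nonneg _)
  have h5 : ∫ x in Bᶜ, hw d K x * u x ^ 2 ≤ ∫ x in Bᶜ, (-E) * u x ^ 2 := by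
    refine setIntegral_mono_on i3.integrableOn (i0.const_mul _).integrableOn hBm.compl
      fun x hx => ?_
    exact mul_le_mul_of_nonneg_right
      ((hw_le_of_notMem (by linarith) (by positivity) hx).trans hE) (sq_nonneg _)
  have hEneg : 0 ≤ -E := le_trans (by positivity) hE
  have h6 : ∫ x in Bᶜ, (-E) * u x ^ 2 ≤ ∫ x, (-E) * u x ^ 2 :=
    setIntegral_le_integral (i0.const_mul _)
      (Eventually.of_forall fun x => mul_nonneg hEneg (sq_nonneg _))
  have h7 := integral_add_compl hBm i3
  have e6 : ∫ x, (-E) * u x ^ 2 = -E * ∫ x, u x ^ 2 := integral_const_mul _ _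
  linarith

/-- Theorem 3.1 (ii), case `ρ = 1`: logarithmic upper eigenvalue bound for vanishing mean value. -/
theorem eigenvalue_upper_bound_zero_mean_rho_one
    (d : ℕ) (hd : 1 ≤ d)
    (W : Ed d → ℝ) (hW : SClass d 2 1 W)
    (η φ : Ed d → ℝ) (hη : IsAdmissible d η 0 φ) :
    ∃ C : ℝ, 0 < C ∧ ∃ E₀ : ℝ, E₀ < 0 ∧ ∀ E ∈ Set.Ioo E₀ (0 : ℝ),
      schN d (fun x => η x * W x) E ≠ ⊤ ∧
      ((schN d (fun x => η x * W x) E).toNat : ℝ) ≤ C * |Real.log (|E|)| := by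
  obtain ⟨K, hK, hV⟩ := aux_form hW hη
  set n : ℕ := ⌈(2 * K) * (4 * (d * 2 ^ d))⌉₊ + 1 with hn
  have hκn : (2 * K) * (4 * ((d:ℝ) * 2 ^ d)) ≤ n := by
    rw [hn]; push_cast
    linarith [Nat.le_ceil ((2 * K) * (4 * ((d:ℝ) * 2 ^ d)))]
  have hn1 : 1 ≤ n := by omega
  have hlK : 0 ≤ Real.log K := Real.log_nonneg hK
  refine ⟨(Real.log K + 3) * (4 * n) ^ d, by positivity, -Real.exp (-1),
    by simp [Real.exp_pos], ?_⟩
  rintro E ⟨hE1, hE2⟩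
  set L := |Real.log (|E|)| with hL
  have hEa : |E| = -E := abs_of_neg hE2
  have hlogneg : Real.log (|E|) < -1 := by
    rw [Real.log_lt_iff_lt_exp (by rw [hEa]; linarith), hEa]; linarith
  have hLeq : Real.log (|E|) = -L := by
    have : L = -Real.log (|E|) := abs_of_neg (by linarith)
    linarith
  have hL1 : 1 ≤ L := by linarith
  set k : ℕ := ⌈Real.log K + L⌉₊ with hk
  have hkE : K / (2 ^ k) ^ 2 ≤ -E := by
    have e1 : -E = Real.exp (-L) := by
      rw [← hLeq, Real.exp_log (by rw [hEa]; linarith), hEa]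
    have e2 : K = Real.exp (Real.log K) := (Real.exp_log (by linarith)).symm
    have h1 : Real.exp (Real.log K + L) ≤ ((2:ℝ) ^ k) ^ 2 := by
      calc Real.exp (Real.log K + L) ≤ Real.exp (k : ℝ) := Real.exp_le_exp.2 (Nat.le_ceil _)
        _ = Real.exp 1 ^ k := by rw [← Real.exp_nat_mul, mul_one]
        _ ≤ 4 ^ k := by
          gcongr
          linarith [Real.exp_one_lt_d9]
        _ = _ := by rw [← pow_mul, mul_comm, pow_mul]; norm_num
    rw [div_le_iff₀ (by positivity), e1]
    calc K = Real.exp (-L) * Real.exp (Real.log K + L) := by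
          rw [← Real.exp_add]; simp [Real.exp_log (show 0 < K by linarith)]
      _ ≤ _ := by gcongr
  have hcount := aux_count hK hV hn1 hκn hkE
  refine ⟨ne_top_of_le_ne_top (ENat.natCast_ne_top _) hcount, ?_⟩
  have hnat := ENat.toNat_le_of_le_natCast hcount
  have hkL : (k : ℝ) + 1 ≤ (Real.log K + 3) * L := by
    have : (k : ℝ) < Real.log K + L + 1 := Nat.ceil_lt_add_one (by linarith)
    nlinarith
  calc _ ≤ (((k + 1) * (4 * n) ^ d : ℕ) : ℝ) := by exact_mod_cast hnat
    _ = ((k : ℝ) + 1) * (4 * n) ^ d := by push_cast; ring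
    _ ≤ ((Real.log K + 3) * L) * (4 * n) ^ d := by gcongr
    _ = _ := by ring

end
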